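/- Let K be a finite connected simplicial complex, p a vertex of K, and M a Morse matching on K with c₀(M) = c₀ > 1 critical vertices and c(M) = c critical simplices in total. Then there exists a Morse matching M̃ on K whose unique critical vertex is p, with c(M̃) = c − 2(c₀ − 1) critical simplices in total, and with cᵢ(M̃) = cᵢ(M) for every i ≥ 2. -/

import Mathlib

variable {V : Type*} [DecidableEq V]

/-- `σ` is a facet (codimension-one face) of `τ`. -/
def Facet (σ τ : Finset V) : Prop := σ ⊆ τ ∧ τ.card = σ.card + 1

/-- A finite abstract simplicial complex: a finite family of nonempty finite sets,
closed under taking nonempty subsets. -/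
def IsComplex (K : Finset (Finset V)) : Prop :=
  (∀ σ ∈ K, σ.Nonempty) ∧ ∀ σ ∈ K, ∀ τ, τ ⊆ σ → τ.Nonempty → τ ∈ K

/-- A partial matching on the complex `K`: a set of pairs `(σ, τ)` with `σ ≺ τ`,
such that every simplex belongs to at most one pair. -/
def IsMatching (K : Finset (Finset V)) (M : Finset (Finset V × Finset V)) : Prop :=
  (∀ p ∈ M, p.1 ∈ K ∧ p.2 ∈ K ∧ Facet p.1 p.2) ∧
  ∀ p ∈ M, ∀ q ∈ M, (p.1 = q.1 ∨ p.1 = q.2 ∨ p.2 = q.1 ∨ p.2 = q.2) → p = q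

/-- Acyclicity of a matching: there is no cycle
`a₀ ≺ b₀ ≻ a₁ ≺ b₁ ≻ ⋯ ≺ b_{n-1} ≻ a₀` with `n ≥ 2`, all `(aᵢ, bᵢ) ∈ M`
and all `bᵢ` distinct. -/
def IsAcyclicMatching (M : Finset (Finset V × Finset V)) : Prop :=
  ¬ ∃ (n : ℕ) (a b : ℕ → Finset V), 2 ≤ n ∧
      (∀ i < n, ∀ j < n, b i = b j → i = j) ∧
      (∀ i < n, (a i, b i) ∈ M) ∧
      (∀ i < n, Facet (a ((i + 1) % n)) (b i))

/-- A Morse matching on `K` is an acyclic partial matching. -/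
def MorseMatching (K : Finset (Finset V)) (M : Finset (Finset V × Finset V)) : Prop :=
  IsMatching K M ∧ IsAcyclicMatching M

/-- A simplex is critical for `M` if it belongs to no pair of `M`. -/
def IsCritical (M : Finset (Finset V × Finset V)) (σ : Finset V) : Prop :=
  ∀ p ∈ M, σ ≠ p.1 ∧ σ ≠ p.2

/-- The number of critical simplices of dimension `i` (i.e. cardinality `i + 1`). -/
noncomputable def critCount (K : Finset (Finset V)) (M : Finset (Finset V × Finset V)) (i : ℕ) : ℕ :=
  {σ : Finset V | σ ∈ K ∧ σ.card = i + 1 ∧ IsCritical M σ}.ncard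

/-- The total number of critical simplices. -/
noncomputable def totalCrit (K : Finset (Finset V)) (M : Finset (Finset V × Finset V)) : ℕ :=
  {σ : Finset V | σ ∈ K ∧ IsCritical M σ}.ncard

/-- `σ` is a free face of `K` with unique proper coface `τ`. -/
def IsFreePair (K : Finset (Finset V)) (σ τ : Finset V) : Prop :=
  σ ∈ K ∧ τ ∈ K ∧ σ ⊂ τ ∧ ∀ ρ ∈ K, σ ⊂ ρ → ρ = τ

/-- An elementary collapse removes a free pair `{σ, τ}` from `K`. -/
def ElemCollapse (K K' : Finset (Finset V)) : Prop :=
  ∃ σ τ : Finset V, IsFreePair K σ τ ∧ K' = K \ {σ, τ}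

/-- `K` collapses to `L` via a finite sequence of elementary collapses. -/
def Collapses (K L : Finset (Finset V)) : Prop :=
  Relation.ReflTransGen ElemCollapse K L

/-- `K` is collapsible if it collapses to a single vertex. -/
def Collapsible (K : Finset (Finset V)) : Prop :=
  ∃ v : V, Collapses K {{v}}

/-- The 1-skeleton of `K` is a connected graph. -/
def SkeletonConnected (K : Finset (Finset V)) : Prop :=
  ∀ u v : V, ({u} : Finset V) ∈ K → ({v} : Finset V) ∈ K →
    Relation.ReflTransGen (fun a b => a ≠ b ∧ ({a, b} : Finset V) ∈ K) u v

/-- A property of simplices that propagates along gradient steps of an acyclic matching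
never holds. -/
lemma not_of_forall_exists_gradient_step {W : Type*} {K : Finset (Finset W)}
    {M : Finset (Finset W × Finset W)}
    (hM : MorseMatching K M) {P : Finset W → Prop}
    (hP : ∀ e, P e → ∃ t e', (e, t) ∈ M ∧ Facet e' t ∧ e' ≠ e ∧ P e') (e : Finset W) : ¬ P e := by
  intro he
  choose t f ht hface hne hPf using fun x : {e // P e} => hP x.1 x.2
  let g : {e // P e} → {e // P e} := fun x => ⟨f x, hPf x⟩
  have hfin : Finite {e // P e} :=
    Finite.of_injective (fun x => (⟨(x.1, t x), ht x⟩ : {q // q ∈ M})) fun x y h => by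
      simp only [Subtype.mk.injEq, Prod.mk.injEq] at h
      exact Subtype.ext h.1
  obtain ⟨x, hx⟩ : ∃ x, x ∈ Function.periodicPts g := by
    obtain ⟨m, n, hmn, h⟩ := Finite.exists_ne_map_eq_of_infinite fun i => g^[i] ⟨e, he⟩
    wlog hlt : m < n generalizing m n
    · exact this n m hmn.symm h.symm (by omega)
    refine ⟨g^[m] ⟨e, he⟩, n - m, by omega, ?_⟩
    rw [Function.IsPeriodicPt, Function.IsFixedPt, ← Function.iterate_add_apply,
      Nat.sub_add_cancel hlt.le]
    exact h.symm
  have hpos := Function.minimalPeriod_pos_of_mem_periodicPts hx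
  have hn1 : Function.minimalPeriod g x ≠ 1 := fun h =>
    hne x (congrArg Subtype.val (Function.minimalPeriod_eq_one_iff_isFixedPt.1 h))
  refine hM.2 ⟨Function.minimalPeriod g x, fun i => (g^[i] x).1, fun i => t (g^[i] x),
    by omega, fun i hi j hj hij => ?_, fun i _ => ht _, fun i _ => ?_⟩
  · have h := hM.1.2 _ (ht (g^[i] x)) _ (ht (g^[j] x)) (by simp [hij])
    exact Function.iterate_injOn_Iio_minimalPeriod hi hj
      (Subtype.ext (congrArg Prod.fst h))
  · simp only [Function.iterate_mod_minimalPeriod_eq, Function.iterate_succ_apply']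
    exact hface _

/-- The graph on `V` whose edges are the edges of `K` not matched with a triangle. -/
def notMatchedUpGraph (K : Finset (Finset V)) (M : Finset (Finset V × Finset V)) :
    SimpleGraph V where
  Adj a b := a ≠ b ∧ ({a, b} : Finset V) ∈ K ∧ ∀ t, (({a, b} : Finset V), t) ∉ M
  symm := ⟨fun a b h => by
    rw [Finset.pair_comm b a]
    exact ⟨h.1.symm, h.2⟩⟩
  loopless := ⟨fun _ h => h.1 rfl⟩

lemma notMatchedUpGraph_reachable_of_edge {K : Finset (Finset V)}
    {M : Finset (Finset V × Finset V)} (hK : IsComplex K) (hM : MorseMatching K M) {u v : V}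
    (huv : u ≠ v) (he : ({u, v} : Finset V) ∈ K) : (notMatchedUpGraph K M).Reachable u v := by
  by_contra hcon
  refine not_of_forall_exists_gradient_step hM
    (P := fun e => ∃ u v, u ≠ v ∧ e = {u, v} ∧ e ∈ K ∧ ¬ (notMatchedUpGraph K M).Reachable u v)
    ?_ {u, v} ⟨u, v, huv, rfl, he, hcon⟩
  rintro _ ⟨u, v, huv, rfl, he, hcon⟩
  obtain ⟨t, ht⟩ : ∃ t, (({u, v} : Finset V), t) ∈ M := by
    by_contra! h
    exact hcon (SimpleGraph.Adj.reachable (G := notMatchedUpGraph K M) ⟨huv, he, h⟩)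
  obtain ⟨-, htK, hsub, hcard⟩ := hM.1.1 _ ht
  dsimp only at htK hsub hcard
  obtain ⟨w, hw, rfl⟩ := (Finset.covBy_iff_exists_insert (s := {u, v}) (t := t)).1
    (Finset.covBy_iff_card_sdiff_eq_one.2 ⟨hsub, by
      rw [Finset.card_sdiff_of_subset hsub]; omega⟩)
  simp only [Finset.mem_insert, Finset.mem_singleton, not_or] at hw
  obtain ⟨hwu, hwv⟩ := hw
  have h3 : (insert w {u, v} : Finset V).card = 3 := by
    rw [hcard, Finset.card_pair huv]
  have key : ∀ a b, a ≠ b → ({a, b} : Finset V) ⊆ insert w {u, v} → w ∈ ({a, b} : Finset V) →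
      ¬ (notMatchedUpGraph K M).Reachable a b → ∃ t e', (({u, v} : Finset V), t) ∈ M ∧
        Facet e' t ∧ e' ≠ {u, v} ∧
        ∃ u v, u ≠ v ∧ e' = {u, v} ∧ e' ∈ K ∧ ¬ (notMatchedUpGraph K M).Reachable u v := by
    intro a b hab hsub hwab hr
    refine ⟨_, {a, b}, ht, ⟨hsub, by rw [h3, Finset.card_pair hab]⟩, ?_, a, b, hab, rfl,
      hK.2 _ htK _ hsub ⟨a, by simp⟩, hr⟩
    intro h
    rw [h] at hwab
    simp [hwu, hwv] at hwab
  by_cases h : (notMatchedUpGraph K M).Reachable u w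
  · refine key w v hwv ?_ (by simp) fun h' => hcon (h.trans h')
    intro x; simp; tauto
  · refine key u w (Ne.symm hwu) ?_ (by simp) h
    intro x; simp; tauto

lemma notMatchedUpGraph_reachable {K : Finset (Finset V)}
    {M : Finset (Finset V × Finset V)} (hK : IsComplex K) (hconn : SkeletonConnected K)
    (hM : MorseMatching K M) {u v : V} (hu : ({u} : Finset V) ∈ K) (hv : ({v} : Finset V) ∈ K) :
    (notMatchedUpGraph K M).Reachable u v := by
  induction hconn u v hu hv with
  | refl => exact .refl _
  | tail _ h ih =>
    refine (ih (hK.2 _ h.2 _ (by simp) (by simp))).trans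
      (notMatchedUpGraph_reachable_of_edge hK hM h.1 h.2)

lemma SimpleGraph.Reachable.exists_adj_dist_lt {W : Type*} {G : SimpleGraph W} {v p : W}
    (h : G.Reachable v p) (hne : v ≠ p) : ∃ w, G.Adj v w ∧ G.dist w p < G.dist v p := by
  obtain ⟨q, hq⟩ := h.exists_walk_length_eq_dist
  cases q with
  | nil => exact absurd rfl hne
  | cons hadj q =>
    refine ⟨_, hadj, ?_⟩
    rw [SimpleGraph.Walk.length_cons] at hq
    have := SimpleGraph.dist_le q
    omega

lemma totalCrit_add_two_mul_card {K : Finset (Finset V)} {M : Finset (Finset V × Finset V)}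
    (hM : IsMatching K M) : totalCrit K M + 2 * M.card = K.card := by
  classical
  have hset : {σ : Finset V | σ ∈ K ∧ IsCritical M σ} = ↑(K.filter (IsCritical M)) := by
    ext; simp
  have h1 : (M.image Prod.fst).card = M.card :=
    Finset.card_image_of_injOn fun a ha b hb h => hM.2 a ha b hb (.inl h)
  have h2 : (M.image Prod.snd).card = M.card :=
    Finset.card_image_of_injOn fun a ha b hb h => hM.2 a ha b hb (.inr (.inr (.inr h)))
  have hd : Disjoint (M.image Prod.fst) (M.image Prod.snd) := by
    rw [Finset.disjoint_left]
    rintro _ ha hb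
    obtain ⟨a, haM, rfl⟩ := Finset.mem_image.1 ha
    obtain ⟨b, hbM, h⟩ := Finset.mem_image.1 hb
    obtain rfl := hM.2 a haM b hbM (.inr (.inl h.symm))
    have := (hM.1 a haM).2.2.2
    rw [h] at this
    omega
  have hnot : K.filter (fun σ => ¬ IsCritical M σ) = M.image Prod.fst ∪ M.image Prod.snd := by
    ext σ
    simp only [Finset.mem_filter, Finset.mem_union, Finset.mem_image]
    constructor
    · rintro ⟨-, h⟩
      unfold IsCritical at h
      push Not at h
      obtain ⟨q, hq, h⟩ := h
      by_cases hσ : σ = q.1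
      · exact .inl ⟨q, hq, hσ.symm⟩
      · exact .inr ⟨q, hq, (h hσ).symm⟩
    · rintro (⟨q, hq, rfl⟩ | ⟨q, hq, rfl⟩)
      · exact ⟨(hM.1 q hq).1, fun h => (h q hq).1 rfl⟩
      · exact ⟨(hM.1 q hq).2.1, fun h => (h q hq).2 rfl⟩
  rw [totalCrit, hset, Set.ncard_coe_finset,
    ← Finset.card_filter_add_card_filter_not (s := K) (IsCritical M), hnot,
    Finset.card_union_of_disjoint hd, h1, h2]
  omega

lemma critCount_zero_add_card {K : Finset (Finset V)} {M : Finset (Finset V × Finset V)}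
    (hK : IsComplex K) (hM : IsMatching K M) :
    critCount K M 0 + (M.filter fun q => ¬ 1 < q.1.card).card
      = (K.filter fun σ => σ.card = 1).card := by
  classical
  have hset : {σ : Finset V | σ ∈ K ∧ σ.card = 0 + 1 ∧ IsCritical M σ} =
      ↑((K.filter fun σ => σ.card = 1).filter (IsCritical M)) := by
    ext; simp [and_assoc]
  have h1 : ((M.filter fun q => ¬ 1 < q.1.card).image Prod.fst).card =
      (M.filter fun q => ¬ 1 < q.1.card).card :=
    Finset.card_image_of_injOn fun a ha b hb h =>
      hM.2 a (Finset.mem_filter.1 ha).1 b (Finset.mem_filter.1 hb).1 (.inl h)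
  have hnot : (K.filter fun σ => σ.card = 1).filter (fun σ => ¬ IsCritical M σ) =
      (M.filter fun q => ¬ 1 < q.1.card).image Prod.fst := by
    ext σ
    simp only [Finset.mem_filter, Finset.mem_image]
    constructor
    · rintro ⟨⟨-, hσ1⟩, h⟩
      unfold IsCritical at h
      push Not at h
      obtain ⟨q, hq, h⟩ := h
      by_cases hσ : σ = q.1
      · exact ⟨q, ⟨hq, by rw [← hσ]; omega⟩, hσ.symm⟩
      · have h2 := (hM.1 q hq).2.2.2
        have := (hK.1 _ (hM.1 q hq).1).card_pos
        rw [← h hσ] at h2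
        omega
    · rintro ⟨q, ⟨hq, hq1⟩, rfl⟩
      have := (hK.1 _ (hM.1 q hq).1).card_pos
      exact ⟨⟨(hM.1 q hq).1, by omega⟩, fun h => (h q hq).1 rfl⟩
  rw [critCount, hset, Set.ncard_coe_finset,
    ← Finset.card_filter_add_card_filter_not (s := K.filter fun σ => σ.card = 1) (IsCritical M),
    hnot, h1]

/-- Replace the vertex–edge pairs of `M` by the pairs `({v}, {v, par v})`, for `v ≠ p` a vertex
of `K`. -/
def rematchVertices (K : Finset (Finset V)) (M : Finset (Finset V × Finset V)) (p : V)
    (par : V → V) : Finset (Finset V × Finset V) :=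
  (M.filter fun q => 1 < q.1.card) ∪
    ((K.biUnion id).erase p).image fun v => ({v}, {v, par v})

lemma mem_rematchVertices {K : Finset (Finset V)} {M : Finset (Finset V × Finset V)} {p : V}
    {par : V → V} (hK : IsComplex K) {q : Finset V × Finset V} :
    q ∈ rematchVertices K M p par ↔ (q ∈ M ∧ 1 < q.1.card) ∨
      ∃ v, v ≠ p ∧ ({v} : Finset V) ∈ K ∧ q = ({v}, {v, par v}) := by
  have hv : ∀ v, v ∈ K.biUnion id ↔ ({v} : Finset V) ∈ K := by
    intro v
    simp only [Finset.mem_biUnion, id]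
    exact ⟨fun ⟨σ, hσ, h⟩ => hK.2 σ hσ _ (by simpa using h) (by simp), fun h => ⟨_, h, by simp⟩⟩
  simp only [rematchVertices, Finset.mem_union, Finset.mem_filter, Finset.mem_image,
    Finset.mem_erase, hv, and_assoc, eq_comm]

lemma morseMatching_rematchVertices {K : Finset (Finset V)} {M : Finset (Finset V × Finset V)}
    {p : V} {par : V → V} {d : V → ℕ} (hK : IsComplex K) (hM : MorseMatching K M)
    (hpar : ∀ v, v ≠ p → ({v} : Finset V) ∈ K →
      (notMatchedUpGraph K M).Adj v (par v) ∧ d (par v) < d v) :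
    MorseMatching K (rematchVertices K M p par) := by
  have hmatch : IsMatching K (rematchVertices K M p par) := by
    constructor
    · intro q hq
      rcases (mem_rematchVertices hK).1 hq with ⟨hq, -⟩ | ⟨v, hvp, hv, rfl⟩
      · exact hM.1.1 q hq
      · have h := (hpar v hvp hv).1
        exact ⟨hv, h.2.1, by simp, by simp [Finset.card_pair h.1]⟩
    · have mixed : ∀ q ∈ M, 1 < q.1.card → ∀ v, v ≠ p → ({v} : Finset V) ∈ K →
          q.1 ≠ {v} ∧ q.1 ≠ {v, par v} ∧ q.2 ≠ {v} ∧ q.2 ≠ {v, par v} := by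
        intro q hq hq1 v hvp hv
        have h := (hpar v hvp hv).1
        have hc := (hM.1.1 q hq).2.2.2
        refine ⟨?_, fun h' => h.2.2 q.2 (h' ▸ hq), ?_, ?_⟩
        · intro h'; simp [h'] at hq1
        · intro h'; rw [h', Finset.card_singleton] at hc; omega
        · intro h'; rw [h', Finset.card_pair h.1] at hc; omega
      intro q hq r hr hqr
      rcases (mem_rematchVertices hK).1 hq with ⟨hq, hq1⟩ | ⟨v, hvp, hv, rfl⟩ <;>
        rcases (mem_rematchVertices hK).1 hr with ⟨hr, hr1⟩ | ⟨w, hwp, hw, rfl⟩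
      · exact hM.1.2 q hq r hr hqr
      · have := mixed q hq hq1 w hwp hw
        tauto
      · have := mixed r hr hr1 v hvp hv
        simp only [eq_comm (b := r.1), eq_comm (b := r.2)] at hqr
        tauto
      · have hv' := hpar v hvp hv
        have hw' := hpar w hwp hw
        suffices v = w by rw [this]
        rcases hqr with h | h | h | h
        · simpa using h
        · have := congrArg Finset.card h
          simp [Finset.card_pair hw'.1.1] at this
        · have := congrArg Finset.card h
          simp [Finset.card_pair hv'.1.1] at this
        · by_contra hne
          have h1 : v ∈ ({w, par w} : Finset V) := by
            rw [← show ({v, par v} : Finset V) = {w, par w} from h]; simp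
          have h2 : w ∈ ({v, par v} : Finset V) := by
            rw [show ({v, par v} : Finset V) = {w, par w} from h]; simp
          simp only [Finset.mem_insert, Finset.mem_singleton, hne, Ne.symm hne, false_or] at h1 h2
          rw [← h1] at hw'
          rw [← h2] at hv'
          exact absurd hv'.2 (by have := hw'.2; omega)
  refine ⟨hmatch, ?_⟩
  rintro ⟨n, a, b, hn, hinj, hmem, hface⟩
  have hstep : ∀ i < n, (a ((i + 1) % n)).card = (a i).card := by
    intro i hi
    have h1 := (hface i hi).2
    have h2 := (hmatch.1 _ (hmem i hi)).2.2.2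
    dsimp only at h2
    omega
  have hcard : ∀ i < n, (a i).card = (a 0).card := by
    intro i
    induction i with
    | zero => intro _; rfl
    | succ i ih =>
      intro hi
      have h := hstep i (by omega)
      rw [Nat.mod_eq_of_lt hi] at h
      rw [h, ih (by omega)]
  by_cases h0 : 1 < (a 0).card
  · refine hM.2 ⟨n, a, b, hn, hinj, fun i hi => ?_, hface⟩
    rcases (mem_rematchVertices hK).1 (hmem i hi) with h | ⟨v, -, -, h⟩
    · exact h.1
    · have := hcard i hi
      rw [(Prod.mk.inj h).1, Finset.card_singleton] at this
      omega
  · have hvert : ∀ i < n, ∃ v, v ≠ p ∧ ({v} : Finset V) ∈ K ∧ a i = {v} ∧ b i = {v, par v} := by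
      intro i hi
      rcases (mem_rematchVertices hK).1 (hmem i hi) with h | ⟨v, hvp, hv, h⟩
      · have := h.2
        rw [hcard i hi] at this
        omega
      · exact ⟨v, hvp, hv, (Prod.mk.inj h).1, (Prod.mk.inj h).2⟩
    have hpot : ∀ i < n, ∑ x ∈ a ((i + 1) % n), d x < ∑ x ∈ a i, d x := by
      intro i hi
      have hj : (i + 1) % n < n := Nat.mod_lt _ (by omega)
      obtain ⟨v, hvp, hv, hav, hbv⟩ := hvert i hi
      obtain ⟨w, hwp, hw, haw, hbw⟩ := hvert _ hj
      have hwv : w ≠ v := by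
        rintro rfl
        have h := hinj i hi _ hj (by rw [hbv, hbw])
        rcases Nat.lt_or_ge (i + 1) n with h' | h'
        · rw [Nat.mod_eq_of_lt h'] at h; omega
        · have : i + 1 = n := by omega
          rw [this, Nat.mod_self] at h; omega
      have hsub := (hface i hi).1
      rw [haw, hbv, Finset.singleton_subset_iff, Finset.mem_insert, Finset.mem_singleton] at hsub
      obtain rfl := hsub.resolve_left hwv
      rw [haw, hav, Finset.sum_singleton, Finset.sum_singleton]
      exact (hpar v hvp hv).2
    obtain ⟨i, hi, hmin⟩ := Finset.exists_min_image (Finset.range n)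
      (fun i => ∑ x ∈ a i, d x) ⟨0, by simp; omega⟩
    rw [Finset.mem_range] at hi
    exact absurd (hpot i hi)
      (not_lt.2 (hmin _ (Finset.mem_range.2 (Nat.mod_lt _ (by omega)))))

/-- Given a finite connected simplicial complex `K`, a vertex `p` of `K`, and a Morse
matching `M` on `K` with `c₀ > 1` critical vertices and `c` critical simplices in
total, there is a Morse matching `M̃` on `K` whose unique critical vertex is `p`,
with `c − 2(c₀ − 1)` critical simplices in total, and with the same number of
`i`-dimensional critical simplices as `M` for every `i ≥ 2`. -/
theorem exists_morse_matching_unique_critical_vertex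
    (K : Finset (Finset V)) (M : Finset (Finset V × Finset V)) (p : V)
    (hK : IsComplex K) (hconn : SkeletonConnected K) (hp : ({p} : Finset V) ∈ K)
    (hM : MorseMatching K M) (c₀ c : ℕ)
    (hc₀ : c₀ = critCount K M 0) (hc : c = totalCrit K M) (h1 : 1 < c₀) :
    ∃ M' : Finset (Finset V × Finset V), MorseMatching K M' ∧
      {σ : Finset V | σ ∈ K ∧ σ.card = 1 ∧ IsCritical M' σ} = {({p} : Finset V)} ∧
      totalCrit K M' = c - 2 * (c₀ - 1) ∧
      ∀ i, 2 ≤ i → critCount K M' i = critCount K M i := by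
  classical
  have hex : ∀ v, ∃ w, v ≠ p → ({v} : Finset V) ∈ K → (notMatchedUpGraph K M).Adj v w ∧
      (notMatchedUpGraph K M).dist w p < (notMatchedUpGraph K M).dist v p := by
    intro v
    by_cases h : v ≠ p ∧ ({v} : Finset V) ∈ K
    · obtain ⟨w, hw⟩ :=
        (notMatchedUpGraph_reachable hK hconn hM h.2 hp).exists_adj_dist_lt h.1
      exact ⟨w, fun _ _ => hw⟩
    · exact ⟨v, fun h1 h2 => absurd ⟨h1, h2⟩ h⟩
  choose par hpar using hex
  have hM' := morseMatching_rematchVertices (d := fun v => (notMatchedUpGraph K M).dist v p)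
    hK hM hpar
  have hcrit0 : {σ : Finset V | σ ∈ K ∧ σ.card = 1 ∧ IsCritical (rematchVertices K M p par) σ} =
      {({p} : Finset V)} := by
    ext σ
    simp only [Set.mem_ofPred_eq, Set.mem_singleton_iff]
    constructor
    · rintro ⟨hσ, hσ1, hcr⟩
      obtain ⟨v, rfl⟩ := Finset.card_eq_one.1 hσ1
      by_contra hne
      exact (hcr _ ((mem_rematchVertices hK).2
        (.inr ⟨v, fun h => hne (by rw [h]), hσ, rfl⟩))).1 rfl
    · rintro rfl
      refine ⟨hp, by simp, fun q hq => ?_⟩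
      rcases (mem_rematchVertices hK).1 hq with ⟨hq, hq1⟩ | ⟨v, hvp, hv, rfl⟩
      · have hc := (hM.1.1 q hq).2.2.2
        constructor <;> intro h <;> have := congrArg Finset.card h <;>
          rw [Finset.card_singleton] at this <;> omega
      · refine ⟨fun h => hvp (by simpa using h.symm), fun h => ?_⟩
        have := congrArg Finset.card h
        simp [Finset.card_pair (hpar v hvp hv).1.1] at this
  have hfilter : (rematchVertices K M p par).filter (fun q => 1 < q.1.card) =
      M.filter fun q => 1 < q.1.card := by
    ext q
    rw [Finset.mem_filter, Finset.mem_filter, mem_rematchVertices hK]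
    constructor
    · rintro ⟨h | ⟨v, -, -, rfl⟩, h'⟩
      · exact h
      · simp at h'
    · exact fun h => ⟨.inl h, h.2⟩
  refine ⟨rematchVertices K M p par, hM', hcrit0, ?_, fun i hi => ?_⟩
  · have hone : critCount K (rematchVertices K M p par) 0 = 1 := by
      rw [critCount, Nat.zero_add, hcrit0, Set.ncard_singleton]
    have e1 := totalCrit_add_two_mul_card hM.1
    have e2 := totalCrit_add_two_mul_card hM'.1
    have e3 := critCount_zero_add_card hK hM.1
    have e4 := critCount_zero_add_card hK hM'.1
    have e5 := Finset.card_filter_add_card_filter_not (s := M) fun q => 1 < q.1.card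
    have e6 := Finset.card_filter_add_card_filter_not (s := rematchVertices K M p par)
      fun q => 1 < q.1.card
    rw [hfilter] at e6
    omega
  · have hiff : ∀ σ : Finset V, σ.card = i + 1 →
        (IsCritical (rematchVertices K M p par) σ ↔ IsCritical M σ) := by
      intro σ hσ
      constructor
      · intro h q hq
        by_cases hq1 : 1 < q.1.card
        · exact h q ((mem_rematchVertices hK).2 (.inl ⟨hq, hq1⟩))
        · have hc := (hM.1.1 q hq).2.2.2
          constructor <;> rintro rfl <;> omega
      · intro h q hq
        rcases (mem_rematchVertices hK).1 hq with ⟨hq, -⟩ | ⟨v, hvp, hv, rfl⟩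
        · exact h q hq
        · constructor <;> rintro rfl
          · rw [Finset.card_singleton] at hσ; omega
          · rw [Finset.card_pair (hpar v hvp hv).1.1] at hσ; omega
    rw [critCount, critCount]
    congr 1
    ext σ
    simp only [Set.mem_ofPred_eq]
    exact and_congr_right fun _ => and_congr_right (hiff σ)
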